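/- arXiv:1103.4672 — 2 statements merged into one kernel-verified Lean document; each statement's English description precedes it below -/
import Mathlib

section
/- Let n ≥ 2 and g ≥ 1 be integers and let x ∈ ℂ satisfy x^g ≠ 1. Then ∑_{j=0}^{g−1} ℓ_{1−n}(e^{2πi·j/g} · x) = g^n · ℓ_{1−n}(x^g); equivalently, (1/g)·∑_{j=0}^{g−1} ℓ_{1−n}(e^{2πi·j/g}·x) = g^{n−1}·ℓ_{1−n}(x^g). (Note that x^g ≠ 1 implies e^{2πi·j/g}·x ≠ 1 for every j, so all terms are defined.) -/
open scoped BigOperators Real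

/-- The rational functions `ℓ_{−k}`, defined inductively by `ℓ_0(z) = z/(1−z)` and
`ℓ_{−(k+1)}(z) = z · (d/dz) ℓ_{−k}(z)`. -/
noncomputable def ell : ℕ → ℂ → ℂ
  | 0 => fun z => z / (1 - z)
  | (k + 1) => fun z => z * deriv (ell k) z

lemma differentiableOn_ell (k : ℕ) : DifferentiableOn ℂ (ell k) {1}ᶜ := by
  induction k with
  | zero =>
    intro z hz
    have h : (1 : ℂ) - z ≠ 0 := sub_ne_zero.mpr (Ne.symm hz)
    have : DifferentiableAt ℂ (fun z : ℂ => z / (1 - z)) z := by fun_prop (disch := exact h)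
    exact this.differentiableWithinAt
  | succ k ih => exact differentiableOn_id.mul (ih.deriv isOpen_compl_singleton)

lemma differentiableAt_ell (k : ℕ) {z : ℂ} (hz : z ≠ 1) : DifferentiableAt ℂ (ell k) z :=
  (differentiableOn_ell k).differentiableAt (isOpen_compl_singleton.mem_nhds hz)

lemma mul_ne_one_of_pow_ne_one {g : ℕ} {w x : ℂ} (hw : w ^ g = 1) (hx : x ^ g ≠ 1) :
    w * x ≠ 1 := by
  intro h
  apply hx
  rw [← one_mul (x ^ g)]
  nth_rw 1 [← hw]
  rw [← mul_pow, h, one_pow]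

lemma IsPrimitiveRoot.pow_pow_eq_one {g : ℕ} {ζ : ℂ} (hζ : IsPrimitiveRoot ζ g) (j : ℕ) :
    (ζ ^ j) ^ g = 1 := by
  rw [pow_right_comm, hζ.pow_eq_one, one_pow]

lemma sum_ell_zero {g : ℕ} {ζ : ℂ} (hζ : IsPrimitiveRoot ζ g) (hg : 1 ≤ g)
    {x : ℂ} (hx : x ^ g ≠ 1) :
    ∑ j ∈ Finset.range g, ell 0 (ζ ^ j * x) = g * ell 0 (x ^ g) := by
  have hx' : 1 - x ^ g ≠ 0 := sub_ne_zero.mpr hx.symm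
  have term (j : ℕ) : ell 0 (ζ ^ j * x)
      = (∑ m ∈ Finset.range g, (ζ ^ j * x) ^ m) / (1 - x ^ g) - 1 := by
    have h1 : 1 - ζ ^ j * x ≠ 0 :=
      sub_ne_zero.mpr (mul_ne_one_of_pow_ne_one (hζ.pow_pow_eq_one j) hx).symm
    have h2 := mul_neg_geom_sum (ζ ^ j * x) g
    rw [mul_pow, hζ.pow_pow_eq_one, one_mul] at h2
    simp only [ell]
    rw [← h2, div_mul_cancel_right₀ (fun h => hx' (by rw [← h2, h, mul_zero]))]
    field_simp
    ring
  have orthogonality : ∑ j ∈ Finset.range g, ∑ m ∈ Finset.range g, (ζ ^ j * x) ^ m = g := by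
    rw [Finset.sum_comm, Finset.sum_eq_single_of_mem 0 (Finset.mem_range.mpr hg)]
    · simp
    · intro m hm hm0
      have hne : ζ ^ m ≠ 1 := hζ.pow_ne_one_of_pos_of_lt hm0 (Finset.mem_range.mp hm)
      have hgeom := mul_neg_geom_sum (ζ ^ m) g
      rw [hζ.pow_pow_eq_one, sub_self, mul_eq_zero] at hgeom
      have hzero := hgeom.resolve_left (sub_ne_zero.mpr hne.symm)
      simp_rw [mul_pow, ← Finset.sum_mul, pow_right_comm ζ _ m, hzero, zero_mul]
  simp_rw [term]
  rw [Finset.sum_sub_distrib, ← Finset.sum_div, orthogonality]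
  simp only [ell, Finset.sum_const, Finset.card_range, nsmul_eq_mul]
  field_simp
  ring

/-- The distribution relation for `ell k`, over the powers of a primitive root of unity. -/
theorem sum_ell {g : ℕ} {ζ : ℂ} (hζ : IsPrimitiveRoot ζ g) (hg : 1 ≤ g) (k : ℕ)
    {x : ℂ} (hx : x ^ g ≠ 1) :
    ∑ j ∈ Finset.range g, ell k (ζ ^ j * x) = (g : ℂ) ^ (k + 1) * ell k (x ^ g) := by
  induction k generalizing x with
  | zero => simpa using sum_ell_zero hζ hg hx
  | succ k ih =>
    have hev : (fun y : ℂ => ∑ j ∈ Finset.range g, ell k (ζ ^ j * y))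
        =ᶠ[nhds x] fun y => (g : ℂ) ^ (k + 1) * ell k (y ^ g) := by
      filter_upwards [(continuous_pow g).continuousAt.eventually_ne hx] with y hy using ih hy
    have hL : HasDerivAt (fun y : ℂ => ∑ j ∈ Finset.range g, ell k (ζ ^ j * y))
        (∑ j ∈ Finset.range g, deriv (ell k) (ζ ^ j * x) * (ζ ^ j * 1)) x := by
      refine HasDerivAt.fun_sum fun j _ => ?_
      have hd := differentiableAt_ell k (mul_ne_one_of_pow_ne_one (hζ.pow_pow_eq_one j) hx)
      exact hd.hasDerivAt.comp x ((hasDerivAt_id x).const_mul (ζ ^ j))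
    have hR : HasDerivAt (fun y : ℂ => (g : ℂ) ^ (k + 1) * ell k (y ^ g))
        ((g : ℂ) ^ (k + 1) * (deriv (ell k) (x ^ g) * (g * x ^ (g - 1)))) x :=
      ((differentiableAt_ell k hx).hasDerivAt.comp x (hasDerivAt_pow g x)).const_mul _
    have key := (hL.congr_of_eventuallyEq hev.symm).unique hR
    have hpow : x * x ^ (g - 1) = x ^ g := mul_pow_sub_one (by omega) x
    calc ∑ j ∈ Finset.range g, ell (k + 1) (ζ ^ j * x)
        = x * ∑ j ∈ Finset.range g, deriv (ell k) (ζ ^ j * x) * (ζ ^ j * 1) := by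
          rw [Finset.mul_sum]
          refine Finset.sum_congr rfl fun j _ => ?_
          simp only [ell]
          ring
      _ = (g : ℂ) ^ (k + 1 + 1) * ell (k + 1) (x ^ g) := by
          rw [key]
          simp only [ell]
          rw [← hpow]
          ring

/-- the distribution relation
`∑_{j<g} ℓ_{1−n}(e^{2πi j/g} x) = g^n · ℓ_{1−n}(x^g)` for `x^g ≠ 1`. -/
theorem stmt7 (n g : ℕ) (hn : 2 ≤ n) (hg : 1 ≤ g) (x : ℂ) (hx : x ^ g ≠ 1) :
    (∑ j ∈ Finset.range g,
        ell (n - 1) (Complex.exp (2 * (π : ℂ) * Complex.I * (j : ℂ) / (g : ℂ)) * x)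
      = (g : ℂ) ^ n * ell (n - 1) (x ^ g)) ∧
    ((1 / (g : ℂ)) * ∑ j ∈ Finset.range g,
        ell (n - 1) (Complex.exp (2 * (π : ℂ) * Complex.I * (j : ℂ) / (g : ℂ)) * x)
      = (g : ℂ) ^ (n - 1) * ell (n - 1) (x ^ g)) := by
  have hg0 : (g : ℂ) ≠ 0 := Nat.cast_ne_zero.mpr (by omega)
  have h := sum_ell (Complex.isPrimitiveRoot_exp g (by omega)) hg (n - 1) hx
  rw [Nat.sub_add_cancel (by omega)] at h
  have hexp (j : ℕ) : Complex.exp (2 * (π : ℂ) * Complex.I * (j : ℂ) / (g : ℂ))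
      = Complex.exp (2 * π * Complex.I / g) ^ j := by
    rw [← Complex.exp_nat_mul]
    congr 1
    ring
  simp_rw [hexp]
  refine ⟨h, ?_⟩
  rw [h, ← mul_pow_sub_one (by omega : n ≠ 0) (g : ℂ)]
  field_simp
end

section
/- Let n ≥ 2 and b ≥ 1 be integers and let α ∈ ℚ/ℤ. Then ∑_{β ∈ ℚ/ℤ, b·β = α} Y_n(β) = b^n · Y_n(α), the sum on the left ranging over the b solutions β of b·β = α in ℚ/ℤ. -/
open scoped BigOperators Real

theorem sum_exp_two_pi_mul_div (b j : ℕ) (hb : b ≠ 0) :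
    ∑ k ∈ Finset.range b, Complex.exp (2 * (π : ℂ) * Complex.I * (k : ℂ) * (j : ℂ) / (b : ℂ)) =
      if b ∣ j then (b : ℂ) else 0 := by
  have hζ := Complex.isPrimitiveRoot_exp b hb
  set ζ := Complex.exp (2 * (π : ℂ) * Complex.I / (b : ℂ)) with hζdef
  have hterm : ∀ k ∈ Finset.range b,
      Complex.exp (2 * (π : ℂ) * Complex.I * (k : ℂ) * (j : ℂ) / (b : ℂ)) = (ζ ^ j) ^ k := by
    intro k _
    rw [hζdef, ← Complex.exp_nat_mul, ← Complex.exp_nat_mul]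
    congr 1
    ring
  rw [Finset.sum_congr rfl hterm]
  split_ifs with h
  · simp [(hζ.pow_eq_one_iff_dvd j).2 h]
  · have h1 : ζ ^ j - 1 ≠ 0 := sub_ne_zero.2 fun e => h ((hζ.pow_eq_one_iff_dvd j).1 e)
    refine (mul_eq_zero.1 ?_).resolve_left h1
    rw [mul_geom_sum, ← pow_mul, mul_comm, pow_mul, hζ.pow_eq_one, one_pow, sub_self]

theorem sum_range_mul_ite_dvd {M : Type*} [AddCommMonoid M] (d b : ℕ) (hb : 0 < b) (g : ℕ → M) :
    ∑ j ∈ Finset.range (d * b), (if b ∣ j then g j else 0) =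
      ∑ i ∈ Finset.range d, g (i * b) := by
  rw [← Finset.sum_filter]
  refine Finset.sum_nbij' (fun j => j / b) (fun i => i * b) ?_ ?_ ?_ ?_ ?_
  · intro j hj
    simp only [Finset.mem_filter, Finset.mem_range] at hj ⊢
    exact (Nat.div_lt_iff_lt_mul hb).2 hj.1
  · intro i hi
    simp only [Finset.mem_filter, Finset.mem_range] at hi ⊢
    exact ⟨Nat.mul_lt_mul_of_pos_right hi hb, dvd_mul_left _ _⟩
  · intro j hj
    exact Nat.div_mul_cancel (Finset.mem_filter.1 hj).2
  · intro i _
    exact Nat.mul_div_cancel i hb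
  · intro j hj
    rw [Nat.div_mul_cancel (Finset.mem_filter.1 hj).2]

theorem addCircle_one_coe_eq_coe_iff (x y : ℚ) :
    (x : AddCircle (1 : ℚ)) = (y : AddCircle (1 : ℚ)) ↔ ∃ m : ℤ, y = x + m := by
  rw [eq_comm, ← sub_eq_zero, ← AddCircle.coe_sub, AddCircle.coe_eq_zero_iff]
  refine exists_congr fun m => ?_
  rw [zsmul_one, eq_sub_iff_add_eq, eq_comm, add_comm]

theorem injOn_addCircle_add_div (x : ℚ) (b : ℕ) :
    Set.InjOn (fun k : ℕ => (((x + k) / b : ℚ) : AddCircle (1 : ℚ))) (Finset.range b) := by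
  intro k hk l hl h
  simp only [Finset.coe_range, Set.mem_Iio] at hk hl
  obtain ⟨m, hm⟩ := (addCircle_one_coe_eq_coe_iff _ _).1 h
  have hb : (b : ℚ) ≠ 0 := Nat.cast_ne_zero.2 (by omega)
  field_simp at hm
  have hm' : (l : ℤ) = k + b * m := by
    have : (l : ℚ) = k + b * m := by linarith
    exact_mod_cast this
  have hmod : (k : ℤ) % b = (l : ℤ) % b := by rw [hm', Int.add_mul_emod_self_left]
  rw [Int.emod_eq_of_lt (by omega) (by omega), Int.emod_eq_of_lt (by omega) (by omega)] at hmod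
  exact_mod_cast hmod

theorem setOf_nsmul_eq_addCircle_coe (x : ℚ) (b : ℕ) (hb : 0 < b) :
    {β : AddCircle (1 : ℚ) | b • β = (x : AddCircle (1 : ℚ))} =
      (fun k : ℕ => (((x + k) / b : ℚ) : AddCircle (1 : ℚ))) '' (Finset.range b : Set ℕ) := by
  have hb0 : (b : ℚ) ≠ 0 := Nat.cast_ne_zero.2 hb.ne'
  ext β
  obtain ⟨q, rfl⟩ := QuotientAddGroup.mk_surjective β
  simp only [Set.mem_ofPred_eq, Set.mem_image, Finset.coe_range, Set.mem_Iio]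
  rw [← AddCircle.coe_nsmul, eq_comm, addCircle_one_coe_eq_coe_iff, nsmul_eq_mul]
  constructor
  · rintro ⟨m, hm⟩
    have hb' : (0 : ℤ) < b := by exact_mod_cast hb
    obtain ⟨k, hk⟩ := Int.eq_ofNat_of_zero_le (Int.emod_nonneg m hb'.ne')
    have hlt := Int.emod_lt_of_pos m hb'
    refine ⟨k, by omega, (addCircle_one_coe_eq_coe_iff _ _).2 ⟨m / b, ?_⟩⟩
    have hdiv : (m : ℚ) = k + b * (m / b : ℤ) := by
      have := Int.emod_add_mul_ediv m b
      rw [hk] at this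
      exact_mod_cast this.symm
    field_simp
    linarith
  · rintro ⟨k, _, h⟩
    obtain ⟨m, hm⟩ := (addCircle_one_coe_eq_coe_iff _ _).1 h
    refine ⟨k + b * m, ?_⟩
    rw [hm]
    push_cast
    field_simp
    ring

/-- if `Y_n : ℚ/ℤ → ℂ` is the function given on the class of `a/b` by
`f^{n−1} ∑_{j<f} e^{2πi a j/b} B_n(j/f)` (for any positive multiple `f` of `b`),
then `∑_{bβ = α} Y_n(β) = b^n · Y_n(α)`. -/
theorem stmt8 (n : ℕ) (hn : 2 ≤ n) (Y : AddCircle (1 : ℚ) → ℂ)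
    (hY : ∀ (a : ℤ) (b f : ℕ), 0 < b → 0 < f → b ∣ f →
      Y ((((a : ℚ) / (b : ℚ)) : ℚ) : AddCircle (1 : ℚ))
        = (f : ℂ) ^ (n - 1) * ∑ j ∈ Finset.range f,
            Complex.exp (2 * (π : ℂ) * Complex.I * (a : ℂ) * (j : ℂ) / (b : ℂ)) *
              Polynomial.aeval ((j : ℂ) / (f : ℂ)) (Polynomial.bernoulli n))
    (b : ℕ) (hb : 1 ≤ b) (α : AddCircle (1 : ℚ)) :
    ∑ᶠ β ∈ {β : AddCircle (1 : ℚ) | b • β = α}, Y β = (b : ℂ) ^ n * Y α := by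
  obtain ⟨x, rfl⟩ := QuotientAddGroup.mk_surjective α
  obtain ⟨a, d, hd, rfl⟩ : ∃ (a : ℤ) (d : ℕ), 0 < d ∧ x = (a : ℚ) / d :=
    ⟨x.num, x.den, x.den_pos, (Rat.num_div_den x).symm⟩
  have hb0 : (b : ℂ) ≠ 0 := Nat.cast_ne_zero.2 (by omega)
  have hd0 : (d : ℂ) ≠ 0 := Nat.cast_ne_zero.2 hd.ne'
  have hfib := setOf_nsmul_eq_addCircle_coe ((a : ℚ) / d) b hb
  have hY' : ∀ k ∈ Finset.range b, Y ((((a : ℚ) / d + k) / b : ℚ) : AddCircle (1 : ℚ)) =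
      ∑ j ∈ Finset.range (d * b), ((d * b : ℕ) : ℂ) ^ (n - 1) *
        (Complex.exp (2 * (π : ℂ) * Complex.I * (a : ℂ) * (j : ℂ) / ((d * b : ℕ) : ℂ)) *
          Polynomial.aeval ((j : ℂ) / ((d * b : ℕ) : ℂ)) (Polynomial.bernoulli n)) *
        Complex.exp (2 * (π : ℂ) * Complex.I * (k : ℂ) * (j : ℂ) / (b : ℂ)) := by
    intro k _
    have hq : ((a : ℚ) / d + k) / b = ((a + k * d : ℤ) : ℚ) / ((d * b : ℕ) : ℚ) := by
      have : (d : ℚ) ≠ 0 := Nat.cast_ne_zero.2 hd.ne'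
      have : (b : ℚ) ≠ 0 := Nat.cast_ne_zero.2 (by omega)
      push_cast
      field_simp
    rw [hq, hY _ _ (d * b) (Nat.mul_pos hd hb) (Nat.mul_pos hd hb) dvd_rfl, Finset.mul_sum]
    refine Finset.sum_congr rfl fun j _ => ?_
    have hexp : 2 * (π : ℂ) * Complex.I * ((a + k * d : ℤ) : ℂ) * (j : ℂ) / ((d * b : ℕ) : ℂ) =
        2 * (π : ℂ) * Complex.I * (a : ℂ) * (j : ℂ) / ((d * b : ℕ) : ℂ) +
          2 * (π : ℂ) * Complex.I * (k : ℂ) * (j : ℂ) / (b : ℂ) := by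
      push_cast
      field_simp
    rw [hexp, Complex.exp_add]
    ring
  change ∑ᶠ β ∈ {β : AddCircle (1 : ℚ) | b • β = (((a : ℚ) / d : ℚ) : AddCircle (1 : ℚ))}, Y β =
    (b : ℂ) ^ n * Y (((a : ℚ) / d : ℚ) : AddCircle (1 : ℚ))
  rw [hfib, finsum_mem_image (injOn_addCircle_add_div _ b), finsum_mem_coe_finset,
    Finset.sum_congr rfl hY', Finset.sum_comm]
  simp_rw [← Finset.mul_sum, sum_exp_two_pi_mul_div b _ (show b ≠ 0 by omega), mul_ite, mul_zero]
  rw [sum_range_mul_ite_dvd d b hb, hY a d d hd hd dvd_rfl, Finset.mul_sum, Finset.mul_sum]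
  refine Finset.sum_congr rfl fun i _ => ?_
  have hexp : 2 * (π : ℂ) * Complex.I * (a : ℂ) * ((i * b : ℕ) : ℂ) / ((d * b : ℕ) : ℂ) =
      2 * (π : ℂ) * Complex.I * (a : ℂ) * (i : ℂ) / (d : ℂ) := by
    push_cast
    field_simp
  have harg : ((i * b : ℕ) : ℂ) / ((d * b : ℕ) : ℂ) = (i : ℂ) / (d : ℂ) := by
    push_cast
    field_simp
  have hpow : (b : ℂ) ^ n = (b : ℂ) ^ (n - 1) * b := by
    rw [← pow_succ, Nat.sub_add_cancel (by omega)]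
  rw [hexp, harg, hpow, Nat.cast_mul, mul_pow]
  ring
end
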